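/- arXiv:1306.0329 — 3 statements merged into one kernel-verified Lean document; each statement's English description precedes it below -/
import Mathlib

section
/- (Gradient estimate for the scheme) Assume (A1) and that m⁰ is finite. If (U^{α,n}_i) solves the scheme (NS) and the CFL condition (CFL′) holds, then for every n ≥ 0, every i ≥ 0 and every α = 1,…,N one has p̲_α ≤ p^{α,n}_{i,+} ≤ p̄_α. -/
open Set Filter

/-- Assumption (A1) for a single Hamiltonian: `H` is `C¹`, coercive
(`H p → +∞` as `|p| → +∞`), non-increasing on `(-∞, p₀]` and non-decreasing on `[p₀, +∞)`. -/
def A1cond (H : ℝ → ℝ) (p₀ : ℝ) : Prop :=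
  ContDiff ℝ 1 H ∧ Tendsto H (cocompact ℝ) atTop ∧
    AntitoneOn H (Iic p₀) ∧ MonotoneOn H (Ici p₀)

/-- The non-increasing envelope `H⁻` of `H` with turning point `p₀`. -/
noncomputable def Hm (H : ℝ → ℝ) (p₀ : ℝ) (p : ℝ) : ℝ :=
  if p ≤ p₀ then H p else H p₀

/-- The non-decreasing envelope `H⁺` of `H` with turning point `p₀`. -/
noncomputable def Hp (H : ℝ → ℝ) (p₀ : ℝ) (p : ℝ) : ℝ :=
  if p ≤ p₀ then H p₀ else H p

/-- One time step of the numerical scheme (NS) on the junction: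
`V` (the values at time `n+1`) is computed from `U` (the values at time `n`).
For `i ≥ 1` on each branch `α` the update uses
`max (H⁺_α(p_{i,-}), H⁻_α(p_{i,+}))`; at the junction point `i = 0` all branches share a
common value and the update uses `max_β H⁻_β(p^β_{0,+})`. -/
def SchemeStep {N : ℕ} (H : Fin N → ℝ → ℝ) (p₀ : Fin N → ℝ) (Δx Δt : ℝ)
    (U V : Fin N → ℕ → ℝ) : Prop :=
  (∀ (α : Fin N) (i : ℕ), 1 ≤ i →
      V α i = U α i - Δt * max (Hp (H α) (p₀ α) ((U α i - U α (i - 1)) / Δx))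
        (Hm (H α) (p₀ α) ((U α (i + 1) - U α i) / Δx))) ∧
  (∀ α β : Fin N, U α 0 = U β 0) ∧
  (∀ α : Fin N, V α 0 = U α 0 - Δt *
      sSup (Set.range fun β : Fin N => Hm (H β) (p₀ β) ((U β 1 - U β 0) / Δx)))

/-- The numerical scheme (NS): `U α n i` is the value on branch `α` at time step `n`
and grid point `i`. -/
def SchemeNS {N : ℕ} (H : Fin N → ℝ → ℝ) (p₀ : Fin N → ℝ) (Δx Δt : ℝ)
    (U : Fin N → ℕ → ℕ → ℝ) : Prop :=
  ∀ n : ℕ, SchemeStep H p₀ Δx Δt (fun α i => U α n i) (fun α i => U α (n + 1) i)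

theorem Hm_eq_comp_min (H : ℝ → ℝ) (p₀ p : ℝ) : Hm H p₀ p = H (min p p₀) := by
  unfold Hm
  split_ifs with h
  · rw [min_eq_left h]
  · rw [min_eq_right (not_le.1 h).le]

theorem Hp_eq_comp_max (H : ℝ → ℝ) (p₀ p : ℝ) : Hp H p₀ p = H (max p p₀) := by
  unfold Hp
  split_ifs with h
  · rw [max_eq_right h]
  · rw [max_eq_left (not_le.1 h).le]

theorem Hp_eq_Hm_comp_neg (H : ℝ → ℝ) (p₀ p : ℝ) :
    Hp H p₀ p = Hm (fun q => H (-q)) (-p₀) (-p) := by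
  rw [Hp_eq_comp_max, Hm_eq_comp_min, min_neg_neg, neg_neg]

theorem A1cond.comp_neg {H : ℝ → ℝ} {p₀ : ℝ} (h : A1cond H p₀) :
    A1cond (fun q => H (-q)) (-p₀) := by
  obtain ⟨hC, hlim, hanti, hmono⟩ := h
  refine ⟨hC.comp contDiff_neg, ?_, ?_, ?_⟩
  · exact hlim.comp (Homeomorph.neg ℝ).isClosedEmbedding.tendsto_cocompact
  · intro x hx y hy hxy
    exact hmono (show p₀ ≤ -y by linarith [mem_Iic.1 hy])
      (show p₀ ≤ -x by linarith [mem_Iic.1 hx]) (neg_le_neg hxy)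
  · intro x hx y hy hxy
    exact hanti (show -y ≤ p₀ by linarith [mem_Ici.1 hy])
      (show -x ≤ p₀ by linarith [mem_Ici.1 hx]) (neg_le_neg hxy)

theorem A1cond.antitone_Hm {H : ℝ → ℝ} {p₀ : ℝ} (h : A1cond H p₀) : Antitone (Hm H p₀) := by
  intro x y hxy
  rw [Hm_eq_comp_min, Hm_eq_comp_min]
  exact h.2.2.1 (mem_Iic.2 (min_le_right _ _)) (mem_Iic.2 (min_le_right _ _)) (min_le_min_right _ hxy)

theorem A1cond.monotone_Hp {H : ℝ → ℝ} {p₀ : ℝ} (h : A1cond H p₀) : Monotone (Hp H p₀) := by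
  intro x y hxy
  rw [Hp_eq_comp_max, Hp_eq_comp_max]
  exact h.2.2.2 (mem_Ici.2 (le_max_right _ _)) (mem_Ici.2 (le_max_right _ _)) (max_le_max_right _ hxy)

theorem A1cond.apply_le_Hm {H : ℝ → ℝ} {p₀ : ℝ} (h : A1cond H p₀) (p : ℝ) :
    H p₀ ≤ Hm H p₀ p := by
  rw [Hm_eq_comp_min]
  exact h.2.2.1 (mem_Iic.2 (min_le_right _ _)) (mem_Iic.2 le_rfl) (min_le_right _ _)

/-- The level sets of `H⁻` above the minimum of `H` have a least element. -/
theorem A1cond.isLeast_Hm_level {H : ℝ → ℝ} {p₀ c : ℝ} (h : A1cond H p₀) (hc : H p₀ ≤ c) :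
    IsLeast {p | Hm H p₀ p = c} (sInf {p | Hm H p₀ p = c}) := by
  have hcont : Continuous H := h.1.continuous
  obtain ⟨a, ha⟩ : ∃ a, ∀ p ≤ a, c < H p :=
    eventually_atBot.1 ((h.2.1.mono_left atBot_le_cocompact).eventually_gt_atTop c)
  refine IsClosed.isLeast_csInf ?_ ?_ ⟨a, ?_⟩
  · simp only [Hm_eq_comp_min]
    exact isClosed_eq (hcont.comp (continuous_id.min continuous_const)) continuous_const
  · obtain ⟨p, hp, hpc⟩ := intermediate_value_Icc' (min_le_right a p₀) hcont.continuousOn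
      ⟨hc, (ha _ (min_le_left a p₀)).le⟩
    exact ⟨p, by rw [mem_ofPred_eq, Hm_eq_comp_min, min_eq_left hp.2, hpc]⟩
  · intro p hp
    rw [mem_ofPred_eq, Hm_eq_comp_min] at hp
    by_contra! hlt
    exact (ha _ ((min_le_left _ _).trans hlt.le)).ne' hp

/-- The level sets of `H⁺` above the minimum of `H` have a greatest element. -/
theorem A1cond.isGreatest_Hp_level {H : ℝ → ℝ} {p₀ c : ℝ} (h : A1cond H p₀) (hc : H p₀ ≤ c) :
    IsGreatest {p | Hp H p₀ p = c} (sSup {p | Hp H p₀ p = c}) := by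
  have hl := h.comp_neg.isLeast_Hm_level (c := c) (by simpa using hc)
  have hg : IsGreatest {p | Hp H p₀ p = c}
      (-sInf {p | Hm (fun q => H (-q)) (-p₀) p = c}) := by
    refine ⟨?_, fun p hp => ?_⟩
    · rw [mem_ofPred_eq, Hp_eq_Hm_comp_neg, neg_neg]
      exact hl.1
    · rw [mem_ofPred_eq, Hp_eq_Hm_comp_neg] at hp
      linarith [hl.2 hp]
  rwa [hg.csSup_eq]

theorem A1cond.le_of_Hm_le {H : ℝ → ℝ} {p₀ c a p : ℝ} (h : A1cond H p₀)
    (ha : IsLeast {p | Hm H p₀ p = c} a) (hp : Hm H p₀ p ≤ c) : a ≤ p := by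
  by_contra! hlt
  have hge : c ≤ Hm H p₀ p := ha.1 ▸ h.antitone_Hm hlt.le
  exact hlt.not_ge (ha.2 (le_antisymm hp hge))

theorem A1cond.le_of_Hp_le {H : ℝ → ℝ} {p₀ c b p : ℝ} (h : A1cond H p₀)
    (hb : IsGreatest {p | Hp H p₀ p = c} b) (hp : Hp H p₀ p ≤ c) : p ≤ b := by
  by_contra! hlt
  have hge : c ≤ Hp H p₀ p := hb.1 ▸ h.monotone_Hp hlt.le
  exact hlt.not_ge (hb.2 (le_antisymm hp hge))

theorem abs_sub_le_of_abs_deriv_le_Icc {H : ℝ → ℝ} (hH : Differentiable ℝ H) {a b K x y : ℝ}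
    (hK : ∀ p ∈ Icc a b, |deriv H p| ≤ K) (hx : x ∈ Icc a b) (hy : y ∈ Icc a b) :
    |H y - H x| ≤ K * |y - x| :=
  (convex_Icc a b).norm_image_sub_le_of_norm_deriv_le (fun p _ => hH p) hK hx hy

/-- One-sided Lipschitz bound for `H⁻` from the left end of an interval containing the
turning point. -/
theorem A1cond.Hm_sub_le {H : ℝ → ℝ} {p₀ a b K p : ℝ} (h : A1cond H p₀)
    (hK : ∀ p ∈ Icc a b, |deriv H p| ≤ K) (ha : a ≤ p₀) (hp : p ∈ Icc a b) :
    Hm H p₀ a - Hm H p₀ p ≤ K * (p - a) := by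
  have hab : a ≤ b := hp.1.trans hp.2
  have hK0 : 0 ≤ K := (abs_nonneg _).trans (hK p hp)
  have ham : a ≤ min p p₀ := le_min hp.1 ha
  have hL := abs_sub_le_of_abs_deriv_le_Icc (h.1.differentiable one_ne_zero) hK
    (x := min p p₀) (y := a) ⟨ham, (min_le_left _ _).trans hp.2⟩ (left_mem_Icc.2 hab)
  rw [abs_sub_comm a, abs_of_nonneg (sub_nonneg.2 ham)] at hL
  rw [Hm_eq_comp_min, Hm_eq_comp_min, min_eq_left ha]
  exact (le_abs_self _).trans (hL.trans
    (mul_le_mul_of_nonneg_left (sub_le_sub_right (min_le_left _ _) _) hK0))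

/-- One-sided Lipschitz bound for `H⁺` from the right end of an interval containing the
turning point. -/
theorem A1cond.Hp_sub_le {H : ℝ → ℝ} {p₀ a b K p : ℝ} (h : A1cond H p₀)
    (hK : ∀ p ∈ Icc a b, |deriv H p| ≤ K) (hb : p₀ ≤ b) (hp : p ∈ Icc a b) :
    Hp H p₀ b - Hp H p₀ p ≤ K * (b - p) := by
  have hab : a ≤ b := hp.1.trans hp.2
  have hK0 : 0 ≤ K := (abs_nonneg _).trans (hK p hp)
  have hmb : max p p₀ ≤ b := max_le hp.2 hb
  have hL := abs_sub_le_of_abs_deriv_le_Icc (h.1.differentiable one_ne_zero) hK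
    (x := max p p₀) (y := b) ⟨hp.1.trans (le_max_left _ _), hmb⟩ (right_mem_Icc.2 hab)
  rw [abs_of_nonneg (sub_nonneg.2 hmb)] at hL
  rw [Hp_eq_comp_max, Hp_eq_comp_max, max_eq_left hb]
  exact (le_abs_self _).trans (hL.trans
    (mul_le_mul_of_nonneg_left (sub_le_sub_left (le_max_left _ _) _) hK0))

theorem SchemeStep.le_sub_Hm {N : ℕ} {H : Fin N → ℝ → ℝ} {p₀ : Fin N → ℝ} {Δx Δt : ℝ}
    {U V : Fin N → ℕ → ℝ} (h : SchemeStep H p₀ Δx Δt U V) (hΔt : 0 ≤ Δt) (α : Fin N) (i : ℕ) :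
    V α i ≤ U α i - Δt * Hm (H α) (p₀ α) ((U α (i + 1) - U α i) / Δx) := by
  rcases Nat.eq_zero_or_pos i with rfl | hi
  · rw [h.2.2 α]
    exact sub_le_sub_left (mul_le_mul_of_nonneg_left
      (le_csSup (finite_range _).bddAbove ⟨α, rfl⟩) hΔt) _
  · rw [h.1 α i hi]
    exact sub_le_sub_left (mul_le_mul_of_nonneg_left (le_max_right _ _) hΔt) _

theorem SchemeStep.le_sub_Hp {N : ℕ} {H : Fin N → ℝ → ℝ} {p₀ : Fin N → ℝ} {Δx Δt : ℝ}
    {U V : Fin N → ℕ → ℝ} (h : SchemeStep H p₀ Δx Δt U V) (hΔt : 0 ≤ Δt) (α : Fin N) (i : ℕ) :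
    V α (i + 1) ≤ U α (i + 1) - Δt * Hp (H α) (p₀ α) ((U α (i + 1) - U α i) / Δx) := by
  rw [h.1 α (i + 1) i.succ_pos]
  exact sub_le_sub_left (mul_le_mul_of_nonneg_left (le_max_left _ _) hΔt) _

/-- A bound on `H⁻` and `H⁺` at all discrete gradients bounds the decrease in one time step. -/
theorem SchemeStep.sub_le {N : ℕ} {H : Fin N → ℝ → ℝ} {p₀ : Fin N → ℝ} {Δx Δt c : ℝ}
    {U V : Fin N → ℕ → ℝ} (h : SchemeStep H p₀ Δx Δt U V) (hΔt : 0 ≤ Δt)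
    (hm : ∀ α i, Hm (H α) (p₀ α) ((U α (i + 1) - U α i) / Δx) ≤ c)
    (hp : ∀ α i, Hp (H α) (p₀ α) ((U α (i + 1) - U α i) / Δx) ≤ c) (α : Fin N) (i : ℕ) :
    U α i - Δt * c ≤ V α i := by
  rcases i with _ | i
  · rw [h.2.2 α]
    refine sub_le_sub_left (mul_le_mul_of_nonneg_left (csSup_le (range_nonempty_iff_nonempty.2 ⟨α⟩) ?_) hΔt) _
    rintro _ ⟨β, rfl⟩
    exact hm β 0
  · rw [h.1 α (i + 1) i.succ_pos]
    exact sub_le_sub_left (mul_le_mul_of_nonneg_left (max_le (hp α i) (hm α (i + 1))) hΔt) _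

/-- **Gradient estimate for the scheme** (Theorem 2.3 (i)).
Assume (A1) and that `m⁰ = inf_{β,i} W^{β,0}_i` is finite (encoded by `IsGLB`).
If `U` solves the scheme (NS) and the CFL condition (CFL′) holds, then for every `n`, `i`
and `α` one has `p̲_α ≤ p^{α,n}_{i,+} ≤ p̄_α`, where
`p̲_α = inf{p | H⁻_α(p) = -m⁰}` and `p̄_α = sup{p | H⁺_α(p) = -m⁰}`. -/
theorem gradient_estimate_scheme {N : ℕ} (hN : 1 ≤ N)
    (H : Fin N → ℝ → ℝ) (p₀ : Fin N → ℝ)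
    (hA1 : ∀ α, A1cond (H α) (p₀ α))
    (Δx Δt : ℝ) (hΔx : 0 < Δx) (hΔt : 0 < Δt)
    (U : Fin N → ℕ → ℕ → ℝ)
    (hU : SchemeNS H p₀ Δx Δt U)
    (m0 : ℝ)
    (hm0 : IsGLB (Set.range fun q : Fin N × ℕ => (U q.1 1 q.2 - U q.1 0 q.2) / Δt) m0)
    (plow pbar : Fin N → ℝ)
    (hplow : ∀ α, plow α = sInf {p : ℝ | Hm (H α) (p₀ α) p = -m0})
    (hpbar : ∀ α, pbar α = sSup {p : ℝ | Hp (H α) (p₀ α) p = -m0})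
    (hCFL : ∀ α : Fin N, ∀ p ∈ Icc (plow α) (pbar α), |deriv (H α) p| ≤ Δx / Δt) :
    ∀ (α : Fin N) (n i : ℕ),
      plow α ≤ (U α n (i + 1) - U α n i) / Δx ∧
      (U α n (i + 1) - U α n i) / Δx ≤ pbar α := by
  have hstart : ∀ α i, U α 0 i - Δt * -m0 ≤ U α 1 i := fun α i => by
    have h := hm0.1 (mem_range_self (α, i))
    rw [le_div_iff₀ hΔt] at h
    linarith
  have hm_start : ∀ α i, Hm (H α) (p₀ α) ((U α 0 (i + 1) - U α 0 i) / Δx) ≤ -m0 := fun α i =>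
    le_of_mul_le_mul_left (by linarith [hstart α i, (hU 0).le_sub_Hm hΔt.le α i]) hΔt
  have hp_start : ∀ α i, Hp (H α) (p₀ α) ((U α 0 (i + 1) - U α 0 i) / Δx) ≤ -m0 := fun α i =>
    le_of_mul_le_mul_left (by linarith [hstart α (i + 1), (hU 0).le_sub_Hp hΔt.le α i]) hΔt
  have hmin : ∀ α, H α (p₀ α) ≤ -m0 := fun α =>
    ((hA1 α).apply_le_Hm _).trans (hm_start α 0)
  have hlow : ∀ α, IsLeast {p | Hm (H α) (p₀ α) p = -m0} (plow α) := fun α =>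
    hplow α ▸ (hA1 α).isLeast_Hm_level (hmin α)
  have hbar : ∀ α, IsGreatest {p | Hp (H α) (p₀ α) p = -m0} (pbar α) := fun α =>
    hpbar α ▸ (hA1 α).isGreatest_Hp_level (hmin α)
  have hlow₀ : ∀ α, plow α ≤ p₀ α := fun α =>
    (hA1 α).le_of_Hm_le (hlow α) (by simpa [Hm] using hmin α)
  have hbar₀ : ∀ α, p₀ α ≤ pbar α := fun α =>
    (hA1 α).le_of_Hp_le (hbar α) (by simpa [Hp] using hmin α)
  suffices h : ∀ n α i, (U α n (i + 1) - U α n i) / Δx ∈ Icc (plow α) (pbar α) from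
    fun α n i => h n α i
  intro n
  induction n with
  | zero =>
    exact fun α i => ⟨(hA1 α).le_of_Hm_le (hlow α) (hm_start α i),
      (hA1 α).le_of_Hp_le (hbar α) (hp_start α i)⟩
  | succ n ih =>
    intro α i
    have hdec := (hU n).sub_le hΔt.le (c := -m0)
      (fun β j => ((hA1 β).antitone_Hm (ih β j).1).trans (hlow β).1.le)
      (fun β j => ((hA1 β).monotone_Hp (ih β j).2).trans (hbar β).1.le) α
    have hmL := (hA1 α).Hm_sub_le (hCFL α) (hlow₀ α) (ih α i)
    have hpL := (hA1 α).Hp_sub_le (hCFL α) (hbar₀ α) (ih α i)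
    have hmS := (hU n).le_sub_Hm hΔt.le α i
    have hpS := (hU n).le_sub_Hp hΔt.le α i
    have h₀ := hdec i
    have h₁ := hdec (i + 1)
    rw [(hlow α).1] at hmL
    rw [(hbar α).1] at hpL
    have hq : (U α n (i + 1) - U α n i) / Δx * Δx = U α n (i + 1) - U α n i :=
      div_mul_cancel₀ _ hΔx.ne'
    generalize (U α n (i + 1) - U α n i) / Δx = q at *
    rw [div_mul_eq_mul_div, le_div_iff₀ hΔt] at hmL hpL
    exact ⟨(le_div_iff₀ hΔx).2 (by linarith), (div_le_iff₀ hΔx).2 (by linarith)⟩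
end

section
/- (Existence of modified Hamiltonians) Let H ∈ C¹(ℝ;ℝ) be coercive and such that there is p₀ ∈ ℝ with H non-increasing on (−∞, p₀] and non-decreasing on [p₀, +∞). Let m⁰ ∈ ℝ and let p̲ ≤ p₀ ≤ p̄ satisfy H(p̲) = H(p̄) = −m⁰, H′(p̲) < 0 and H′(p̄) > 0. Then there exists a function H̃ ∈ C¹(ℝ;ℝ) such that: H̃ = H on [p̲, p̄]; H̃ is strictly decreasing on (−∞, p̲] and strictly increasing on [p̄, +∞); 0 < |H̃′(p)| < sup{|H′(q)| : q ∈ [p̲, p̄]} for every p ∉ [p̲, p̄]; H̃(p) > −m⁰ for every p ∉ [p̲, p̄]; and H̃(p) → +∞ as |p| → +∞. -/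
open Set Filter

/-- A continuous extension of `g` from `[a, b]` to `ℝ` which, away from the
interval, decays from the boundary value to half of it. -/
noncomputable def dampedExtension (g : ℝ → ℝ) (a b p : ℝ) : ℝ :=
  g (max a (min b p)) * ((1 + (1 + |p - max a (min b p)|)⁻¹) / 2)

theorem continuous_dampedExtension {g : ℝ → ℝ} (hg : Continuous g) (a b : ℝ) :
    Continuous (dampedExtension g a b) := by
  unfold dampedExtension
  have h : ∀ p : ℝ, 1 + |p - max a (min b p)| ≠ 0 := fun p => by positivity
  fun_prop (disch := exact h _)

theorem dampedExtension_of_mem {g : ℝ → ℝ} {a b p : ℝ} (hp : p ∈ Icc a b) :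
    dampedExtension g a b p = g p := by
  simp [dampedExtension, min_eq_right hp.2, max_eq_right hp.1]

theorem half_lt_damping {t : ℝ} (ht : 0 ≤ t) : 1 / 2 < (1 + (1 + t)⁻¹) / 2 := by
  have : 0 < (1 + t)⁻¹ := by positivity
  linarith

theorem damping_lt_one {t : ℝ} (ht : 0 < t) : (1 + (1 + t)⁻¹) / 2 < 1 := by
  have : (1 + t)⁻¹ < 1 := inv_lt_one_of_one_lt₀ (by linarith)
  linarith

theorem dampedExtension_of_lt {g : ℝ → ℝ} {a b p : ℝ} (hab : a ≤ b) (hg : g a < 0) (hp : p < a) :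
    g a < dampedExtension g a b p ∧ dampedExtension g a b p < g a / 2 := by
  have hc : max a (min b p) = a := by
    rw [min_eq_right (hp.le.trans hab), max_eq_left hp.le]
  have ht : 0 < |p - a| := abs_pos.2 (sub_ne_zero.2 hp.ne)
  rw [dampedExtension, hc]
  constructor <;> nlinarith [half_lt_damping ht.le, damping_lt_one ht]

theorem dampedExtension_of_gt {g : ℝ → ℝ} {a b p : ℝ} (hab : a ≤ b) (hg : 0 < g b) (hp : b < p) :
    g b / 2 < dampedExtension g a b p ∧ dampedExtension g a b p < g b := by
  have hc : max a (min b p) = b := by rw [min_eq_left hp.le, max_eq_right hab]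
  have ht : 0 < |p - b| := abs_pos.2 (sub_ne_zero.2 hp.ne')
  rw [dampedExtension, hc]
  constructor <;> nlinarith [half_lt_damping ht.le, damping_lt_one ht]

/-- **Existence of modified Hamiltonians** (Step 1 of the proof of Theorem 2.3).
Let `H` be `C¹`, coercive, non-increasing on `(-∞, p₀]` and non-decreasing on `[p₀, +∞)`.
Let `m0 ∈ ℝ` and `p̲ ≤ p₀ ≤ p̄` with `H(p̲) = H(p̄) = -m0`, `H'(p̲) < 0` and `H'(p̄) > 0`.
Then there is `H̃ ∈ C¹(ℝ)` with: `H̃ = H` on `[p̲, p̄]`; `H̃` strictly decreasing on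
`(-∞, p̲]` and strictly increasing on `[p̄, +∞)`; `0 < |H̃'(p)| < sup{|H'(q)| : q ∈ [p̲, p̄]}`
for every `p ∉ [p̲, p̄]`; `H̃ > -m0` outside `[p̲, p̄]`; and `H̃(p) → +∞` as `|p| → +∞`. -/
theorem modified_hamiltonian_exists
    (H : ℝ → ℝ) (p₀ : ℝ)
    (hC1 : ContDiff ℝ 1 H)
    (hcoer : Tendsto H (cocompact ℝ) atTop)
    (hanti : AntitoneOn H (Iic p₀)) (hmono : MonotoneOn H (Ici p₀))
    (m0 pl pu : ℝ) (hpl : pl ≤ p₀) (hpu : p₀ ≤ pu)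
    (hHpl : H pl = -m0) (hHpu : H pu = -m0)
    (hdl : deriv H pl < 0) (hdu : 0 < deriv H pu) :
    ∃ Ht : ℝ → ℝ, ContDiff ℝ 1 Ht ∧
      (∀ p ∈ Icc pl pu, Ht p = H p) ∧
      StrictAntiOn Ht (Iic pl) ∧
      StrictMonoOn Ht (Ici pu) ∧
      (∀ p, p ∉ Icc pl pu →
        0 < |deriv Ht p| ∧ |deriv Ht p| < sSup ((fun q => |deriv H q|) '' Icc pl pu)) ∧
      (∀ p, p ∉ Icc pl pu → -m0 < Ht p) ∧
      Tendsto Ht (cocompact ℝ) atTop := by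
  have hab : pl ≤ pu := hpl.trans hpu
  have hcont : Continuous (deriv H) := hC1.continuous_deriv le_rfl
  have hgc := continuous_dampedExtension hcont pl pu
  set g := dampedExtension (deriv H) pl pu
  set F : ℝ → ℝ := fun p => -m0 + ∫ x in pl..p, g x with hF
  have hder : ∀ p, HasDerivAt F (g p) p := fun p =>
    (intervalIntegral.integral_hasDerivAt_right (hgc.intervalIntegrable _ _)
      (hgc.stronglyMeasurableAtFilter _ _) hgc.continuousAt).const_add _
  have hderiv : deriv F = g := funext fun p => (hder p).deriv
  have hdiff : Differentiable ℝ F := fun p => (hder p).differentiableAt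
  have heq : ∀ p ∈ Icc pl pu, F p = H p := by
    intro p hp
    have h1 : ∫ x in pl..p, g x = ∫ x in pl..p, deriv H x := by
      refine intervalIntegral.integral_congr fun x hx => ?_
      rw [uIcc_of_le hp.1] at hx
      exact dampedExtension_of_mem ⟨hx.1, hx.2.trans hp.2⟩
    have h2 : ∫ x in pl..p, deriv H x = H p - H pl :=
      intervalIntegral.integral_deriv_eq_sub
        (fun x _ => (hC1.differentiable one_ne_zero).differentiableAt)
        (hcont.intervalIntegrable _ _)
    simp only [hF]
    rw [h1, h2, hHpl]
    ring
  have hFl : F pl = -m0 := (heq pl (left_mem_Icc.2 hab)).trans hHpl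
  have hFu : F pu = -m0 := (heq pu (right_mem_Icc.2 hab)).trans hHpu
  have hlt : ∀ p < pl, deriv H pl < g p ∧ g p < deriv H pl / 2 := fun p hp =>
    dampedExtension_of_lt hab hdl hp
  have hgt : ∀ p, pu < p → deriv H pu / 2 < g p ∧ g p < deriv H pu := fun p hp =>
    dampedExtension_of_gt hab hdu hp
  have hsa : StrictAntiOn F (Iic pl) := by
    refine strictAntiOn_of_deriv_neg (convex_Iic _) hdiff.continuous.continuousOn fun p hp => ?_
    rw [interior_Iic] at hp
    rw [hderiv]
    linarith [(hlt p hp).2]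
  have hsm : StrictMonoOn F (Ici pu) := by
    refine strictMonoOn_of_deriv_pos (convex_Ici _) hdiff.continuous.continuousOn fun p hp => ?_
    rw [interior_Ici] at hp
    rw [hderiv]
    linarith [(hgt p hp).1]
  have hout : ∀ p, p ∉ Icc pl pu → p < pl ∨ pu < p := by
    intro p hp
    by_contra! h
    exact hp h
  have hbdd : BddAbove ((fun q => |deriv H q|) '' Icc pl pu) :=
    (isCompact_Icc.image hcont.abs).bddAbove
  refine ⟨F, ?_, heq, hsa, hsm, ?_, ?_, ?_⟩
  · exact contDiff_one_iff_deriv.2 ⟨hdiff, hderiv ▸ hgc⟩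
  · intro p hp
    rw [hderiv]
    rcases hout p hp with h | h
    · obtain ⟨h1, h2⟩ := hlt p h
      have hneg : g p < 0 := by linarith
      refine ⟨abs_pos.2 hneg.ne, lt_of_lt_of_le ?_
        (le_csSup hbdd (mem_image_of_mem _ (left_mem_Icc.2 hab)))⟩
      simpa only [abs_of_neg hneg, abs_of_neg hdl] using neg_lt_neg h1
    · obtain ⟨h1, h2⟩ := hgt p h
      have hpos : 0 < g p := by linarith
      refine ⟨abs_pos.2 hpos.ne', lt_of_lt_of_le ?_
        (le_csSup hbdd (mem_image_of_mem _ (right_mem_Icc.2 hab)))⟩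
      simpa only [abs_of_pos hpos, abs_of_pos hdu] using h2
  · intro p hp
    rcases hout p hp with h | h
    · exact hFl ▸ hsa h.le self_mem_Iic h
    · exact hFu ▸ hsm self_mem_Ici h.le h
  · rw [cocompact_eq_atBot_atTop]
    refine Tendsto.sup ?_ ?_
    · have hlin : Tendsto (fun p : ℝ => -m0 - deriv H pl / 2 * (pl - p)) atBot atTop := by
        have h := (tendsto_neg_atBot_atTop (G := ℝ)).const_mul_atTop
          (show 0 < -(deriv H pl / 2) by linarith)
        refine (tendsto_atTop_add_const_left _ (-m0 - deriv H pl / 2 * pl) h).congr fun p => ?_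
        ring
      refine tendsto_atTop_mono' _ ?_ hlin
      filter_upwards [eventually_le_atBot pl] with p hp
      have := (convex_Iic pl).image_sub_le_mul_sub_of_deriv_le hdiff.continuous.continuousOn
        hdiff.differentiableOn (C := deriv H pl / 2)
        (fun x hx => by rw [interior_Iic] at hx; rw [hderiv]; exact (hlt x hx).2.le)
        p hp pl self_mem_Iic hp
      linarith
    · have hlin : Tendsto (fun p : ℝ => -m0 + deriv H pu / 2 * (p - pu)) atTop atTop := by
        have h := (tendsto_id (α := ℝ) (x := atTop)).const_mul_atTop (half_pos hdu)
        refine (tendsto_atTop_add_const_left _ (-m0 - deriv H pu / 2 * pu) h).congr fun p => ?_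
        simp only [id]
        ring
      refine tendsto_atTop_mono' _ ?_ hlin
      filter_upwards [eventually_ge_atTop pu] with p hp
      have := (convex_Ici pu).mul_sub_le_image_sub_of_le_deriv hdiff.continuous.continuousOn
        hdiff.differentiableOn (C := deriv H pu / 2)
        (fun x hx => by rw [interior_Ici] at hx; rw [hderiv]; exact (hgt x hx).1.le)
        pu self_mem_Ici p hp hp
      linarith
end

section
/- (Comparison of the initial discrete bounds with the Lipschitz bounds, upper part) Assume (A0) and (A1) and let the scheme be initialized by U^{α,0}_i = u₀^α(iΔx). Then M⁰ ≤ M⁰₀, where M⁰ = sup{W^{α,0}_i : α = 1,…,N, i ∈ ℕ}. -/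
open Set Filter

theorem Hm_antitone {H : ℝ → ℝ} {p₀ : ℝ} (hH : AntitoneOn H (Iic p₀)) : Antitone (Hm H p₀) := by
  intro p q hpq
  unfold Hm
  split_ifs with hq hp hp
  · exact hH hp hq hpq
  · exact absurd (hpq.trans hq) hp
  · exact hH hp (mem_Iic.2 le_rfl) hp
  · exact le_rfl

theorem Hp_monotone {H : ℝ → ℝ} {p₀ : ℝ} (hH : MonotoneOn H (Ici p₀)) : Monotone (Hp H p₀) := by
  intro p q hpq
  unfold Hp
  split_ifs with hp hq hq
  · exact le_rfl
  · exact hH (mem_Ici.2 le_rfl) (not_le.1 hq).le (not_le.1 hq).le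
  · exact absurd (hpq.trans hq) hp
  · exact hH (not_le.1 hp).le (not_le.1 hq).le hpq

/-- **Comparison of the initial discrete bounds with the Lipschitz bounds, upper part**
(Step 2 of the proof of Lemma 3.6). Assume (A0) and (A1) and initialize the scheme by
`U^{α,0}_i = u₀^α(iΔx)`. Then `M⁰ ≤ M⁰₀`, where `M⁰ = sup_{α,i} W^{α,0}_i`. -/
theorem initial_bounds_upper_part {N : ℕ} (hN : 1 ≤ N)
    (H : Fin N → ℝ → ℝ) (p₀ : Fin N → ℝ)
    (hA1 : ∀ α, A1cond (H α) (p₀ α))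
    (u₀ : Fin N → ℝ → ℝ)
    (hcompat : ∀ α β : Fin N, u₀ α 0 = u₀ β 0)
    (Lm Lp : Fin N → ℝ)
    (hLp : ∀ α, IsLeast
      {L : ℝ | ∀ x a : ℝ, 0 ≤ x → 0 ≤ a → u₀ α (x + a) - u₀ α x ≤ a * L} (Lp α))
    (hLm : ∀ α, IsGreatest
      {L : ℝ | ∀ x a : ℝ, 0 ≤ x → 0 ≤ a → a * L ≤ u₀ α (x + a) - u₀ α x} (Lm α))
    (Δx Δt : ℝ) (hΔx : 0 < Δx) (hΔt : 0 < Δt)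
    (U0 U1 : Fin N → ℕ → ℝ)
    (hstep : SchemeStep H p₀ Δx Δt U0 U1)
    (hinit : ∀ (α : Fin N) (i : ℕ), U0 α i = u₀ α (i * Δx))
    (M0 : ℝ)
    (hM0 : M0 = sSup (Set.range fun q : Fin N × ℕ => (U1 q.1 q.2 - U0 q.1 q.2) / Δt))
    (M00 : ℝ)
    (hM00 : M00 = max
      (sSup (Set.range fun α : Fin N =>
        min (-(Hp (H α) (p₀ α) (Lm α))) (-(Hm (H α) (p₀ α) (Lp α)))))
      (sInf (Set.range fun α : Fin N => -(Hm (H α) (p₀ α) (Lp α))))) :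
    M0 ≤ M00 := by
  obtain ⟨hint, -, hjunction⟩ := hstep
  have : Nonempty (Fin N) := ⟨⟨0, hN⟩⟩
  have hslope_le (α : Fin N) (i : ℕ) : (U0 α (i + 1) - U0 α i) / Δx ≤ Lp α := by
    rw [div_le_iff₀ hΔx, hinit, hinit, mul_comm (Lp α), Nat.cast_succ, add_one_mul]
    exact (hLp α).1 (i * Δx) Δx (by positivity) hΔx.le
  have hle_slope (α : Fin N) (i : ℕ) : Lm α ≤ (U0 α (i + 1) - U0 α i) / Δx := by
    rw [le_div_iff₀ hΔx, hinit, hinit, mul_comm (Lm α), Nat.cast_succ, add_one_mul]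
    exact (hLm α).1 (i * Δx) Δx (by positivity) hΔx.le
  have hHm (α : Fin N) (i : ℕ) :
      Hm (H α) (p₀ α) (Lp α) ≤ Hm (H α) (p₀ α) ((U0 α (i + 1) - U0 α i) / Δx) :=
    Hm_antitone (hA1 α).2.2.1 (hslope_le α i)
  have hHp (α : Fin N) (i : ℕ) :
      Hp (H α) (p₀ α) (Lm α) ≤ Hp (H α) (p₀ α) ((U0 α (i + 1) - U0 α i) / Δx) :=
    Hp_monotone (hA1 α).2.2.2 (hle_slope α i)
  have hquot (a b : ℝ) : (a - Δt * b - a) / Δt = -b := by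
    field_simp
    ring
  rw [hM0, hM00]
  refine ciSup_le ?_
  rintro ⟨α, _ | i⟩
  · refine le_max_of_le_right (le_ciInf fun β => ?_)
    simp only [hjunction, hquot]
    exact neg_le_neg ((hHm β 0).trans (le_ciSup (Set.finite_range fun β : Fin N =>
      Hm (H β) (p₀ β) ((U0 β 1 - U0 β 0) / Δx)).bddAbove β))
  · refine le_max_of_le_left (le_trans ?_ (le_ciSup (Set.finite_range fun α : Fin N =>
      min (-(Hp (H α) (p₀ α) (Lm α))) (-(Hm (H α) (p₀ α) (Lp α)))).bddAbove α))
    simp only [hint α (i + 1) i.succ_pos, hquot, Nat.add_sub_cancel]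
    exact le_min (neg_le_neg ((hHp α i).trans (le_max_left _ _)))
      (neg_le_neg ((hHm α (i + 1)).trans (le_max_right _ _)))
end
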